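/- Let (X,d) be a compact metric space, ε > 0, c : X×X → ℝ a cost satisfying Assumption (A1), μ, μ′, ν, ν′ probability measures on X, π ∈ Π(μ,ν), k₁ the entropic transport kernel of a Schrödinger pair for (μ′,μ), k₂ the entropic transport kernel of a Schrödinger pair for (ν,ν′), and t(x′,y′) := ∫ k₁(x′,x)·k₂(y,y′) dπ(x,y). Then: (i) sup_{(x′,y′)∈X×X} t(x′,y′) ≤ exp(2·Lip(c)) / max{ inf_{x∈spt(μ)} μ(B(x,ε)), inf_{y∈spt(ν)} ν(B(y,ε)) }; (ii) for all x′, x″, y′ ∈ X: |t(x′,y′) − t(x″,y′)| ≤ (2·Lip(c)·exp(2·Lip(c)) / (ε·inf_{x∈spt(μ)} μ(B(x,ε))))·d(x′,x″). -/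

import Mathlib

open MeasureTheory
open scoped ENNReal

/-- The support of a measure on a metric space: points all of whose
neighbourhoods have positive measure. -/
def mSupport {X : Type*} [MetricSpace X] [MeasurableSpace X] (μ : Measure X) : Set X :=
  {x | ∀ r : ℝ, 0 < r → 0 < μ (Metric.ball x r)}

/-- A Schrödinger pair for `(μ, ν)` with cost `c` and regularization `ε`,
together with the associated entropic transport kernel and its normalizations. -/
def IsSchrodingerKernel {X : Type*} [MetricSpace X] [MeasurableSpace X]
    (ε : ℝ) (c : X → X → ℝ) (μ ν : Measure X) (k : X → X → ℝ) : Prop :=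
  ∃ α β : X → ℝ, Continuous α ∧ Continuous β ∧
    (∀ x, α x = -ε * Real.log (∫ y, Real.exp ((β y - c x y) / ε) ∂ν)) ∧
    (∀ y, β y = -ε * Real.log (∫ x, Real.exp ((α x - c x y) / ε) ∂μ)) ∧
    (∀ x y, k x y = Real.exp ((α x + β y - c x y) / ε)) ∧
    (∀ y, ∫ x, k x y ∂μ = 1) ∧ (∀ x, ∫ y, k x y ∂ν = 1)

section SmoothedKernel

variable {X : Type*} [MetricSpace X] [MeasurableSpace X]

theorem ae_mem_mSupport [CompactSpace X] (μ : Measure X) : ∀ᵐ x ∂μ, x ∈ mSupport μ := by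
  refine measure_null_of_locally_null _ fun x hx => ?_
  simp only [mSupport, Set.mem_compl_iff, Set.mem_ofPred_eq, not_forall, not_lt,
    nonpos_iff_eq_zero] at hx
  obtain ⟨r, hr, h⟩ := hx
  exact ⟨_, mem_nhdsWithin_of_mem_nhds (Metric.ball_mem_nhds x hr), h⟩

theorem iInf_mSupport_ball_pos [CompactSpace X] (μ : Measure X) [IsProbabilityMeasure μ]
    {ε : ℝ} (hε : 0 < ε) :
    0 < ⨅ x : mSupport μ, (μ (Metric.ball (x : X) ε)).toReal := by
  obtain ⟨x₀, hx₀⟩ := (ae_mem_mSupport μ).exists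
  have : Nonempty (mSupport μ) := ⟨⟨x₀, hx₀⟩⟩
  obtain ⟨s, -, hsf, hs⟩ := finite_cover_balls_of_compact (isCompact_univ (X := X)) (half_pos hε)
  obtain ⟨δ, hδ, hδs⟩ : ∃ δ > 0, ∀ z ∈ s, μ (Metric.ball z (ε / 2)) ≠ 0 →
      δ ≤ (μ (Metric.ball z (ε / 2))).toReal := by
    clear hs
    induction s, hsf using Set.Finite.induction_on with
    | empty => exact ⟨1, one_pos, by simp⟩
    | @insert a s _ _ ih =>
      obtain ⟨δ, hδ, h⟩ := ih
      by_cases ha : μ (Metric.ball a (ε / 2)) = 0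
      · refine ⟨δ, hδ, ?_⟩
        rintro z (rfl | hz) h0
        · exact absurd ha h0
        · exact h z hz h0
      · refine ⟨min δ (μ (Metric.ball a (ε / 2))).toReal,
          lt_min hδ (ENNReal.toReal_pos ha (measure_ne_top _ _)), ?_⟩
        rintro z (rfl | hz) h0
        · exact min_le_right _ _
        · exact (min_le_left _ _).trans (h z hz h0)
  refine hδ.trans_le (le_ciInf fun ⟨x, hx⟩ => ?_)
  obtain ⟨z, hz, hxz⟩ := Set.mem_iUnion₂.1 (hs (Set.mem_univ x))
  have hdist : dist x z < ε / 2 := hxz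
  have hle : μ (Metric.ball z (ε / 2)) ≤ μ (Metric.ball x ε) :=
    measure_mono (Metric.ball_subset_ball' (by rw [dist_comm]; linarith))
  refine (hδs z hz fun h0 => ?_).trans (ENNReal.toReal_mono (measure_ne_top _ _) hle)
  refine (hx (ε / 2 - dist x z) (by linarith)).ne' (measure_mono_null ?_ h0)
  exact Metric.ball_subset_ball' (by linarith)

theorem iInf_mSupport_ball_le (μ : Measure X) (ε : ℝ) {x : X} (hx : x ∈ mSupport μ) :
    ⨅ x : mSupport μ, (μ (Metric.ball (x : X) ε)).toReal ≤ (μ (Metric.ball x ε)).toReal :=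
  ciInf_le (f := fun x : mSupport μ => (μ (Metric.ball (x : X) ε)).toReal)
    ⟨0, by rintro _ ⟨y, rfl⟩; exact ENNReal.toReal_nonneg⟩ ⟨x, hx⟩

variable [CompactSpace X] [BorelSpace X]

theorem Continuous.integrable_of_compactSpace {f : X → ℝ} (hf : Continuous f)
    (μ : Measure X) [IsFiniteMeasure μ] : Integrable f μ :=
  hf.integrable_of_hasCompactSupport (HasCompactSupport.of_compactSpace f)

theorem softmin_sub_le {ε : ℝ} (hε : 0 < ε) {c : X → X → ℝ} (hc : ∀ x, Continuous (c x)) {L : ℝ}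
    (hlip : ∀ x x' y, |c x y - c x' y| ≤ L * dist x x') (ν : Measure X) [IsProbabilityMeasure ν]
    {f g : X → ℝ} (hg : Continuous g)
    (hf : ∀ x, f x = -ε * Real.log (∫ y, Real.exp ((g y - c x y) / ε) ∂ν)) (x x' : X) :
    f x - f x' ≤ L * dist x x' := by
  have hint (x : X) : Integrable (fun y => Real.exp ((g y - c x y) / ε)) ν :=
    (Real.continuous_exp.comp ((hg.sub (hc x)).div_const ε)).integrable_of_compactSpace ν
  have hpos (x : X) : 0 < ∫ y, Real.exp ((g y - c x y) / ε) ∂ν := integral_exp_pos (hint x)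
  have hle : ∫ y, Real.exp ((g y - c x' y) / ε) ∂ν ≤
      Real.exp (L * dist x x' / ε) * ∫ y, Real.exp ((g y - c x y) / ε) ∂ν := by
    rw [← integral_const_mul]
    refine integral_mono (hint x') ((hint x).const_mul _) fun y => ?_
    simp only [← Real.exp_add, ← add_div]
    gcongr
    linarith [(abs_le.1 (hlip x x' y)).2]
  have hlog := Real.log_le_log (hpos x') hle
  rw [Real.log_mul (Real.exp_ne_zero _) (hpos x).ne', Real.log_exp] at hlog
  have := mul_le_mul_of_nonneg_left hlog hε.le
  rw [mul_add, mul_div_cancel₀ _ hε.ne'] at this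
  rw [hf, hf]
  linarith

/-- A positive density with `ε * log` Lipschitz is bounded by the inverse mass of `ε`-balls. -/
theorem exp_density_le {ε : ℝ} (hε : 0 < ε) (μ : Measure X) [IsProbabilityMeasure μ]
    {φ : X → ℝ} (hφ : Continuous φ) {K : ℝ} (hK : 0 ≤ K)
    (hlip : ∀ x x', φ x - φ x' ≤ K * dist x x')
    (hint : ∫ x, Real.exp (φ x / ε) ∂μ = 1) {x : X} (hx : x ∈ mSupport μ) :
    Real.exp (φ x / ε) ≤
      Real.exp K / ⨅ x : mSupport μ, (μ (Metric.ball (x : X) ε)).toReal := by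
  have hi : Integrable (fun x => Real.exp (φ x / ε)) μ :=
    (Real.continuous_exp.comp (hφ.div_const ε)).integrable_of_compactSpace μ
  have key : (μ (Metric.ball x ε)).toReal * Real.exp (φ x / ε - K) ≤ 1 := by
    calc (μ (Metric.ball x ε)).toReal * Real.exp (φ x / ε - K)
        = ∫ _ in Metric.ball x ε, Real.exp (φ x / ε - K) ∂μ := by
          simp [Measure.real]
      _ ≤ ∫ y in Metric.ball x ε, Real.exp (φ y / ε) ∂μ := by
          refine setIntegral_mono_on (by simp) hi.integrableOn
            Metric.isOpen_ball.measurableSet fun y hy => ?_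
          have h1 := hlip x y
          have h2 : K * dist x y ≤ K * ε :=
            mul_le_mul_of_nonneg_left (by rw [dist_comm]; exact (Metric.mem_ball.1 hy).le) hK
          rw [Real.exp_le_exp, sub_le_iff_le_add, div_add' _ _ _ hε.ne']
          gcongr
          linarith
      _ ≤ ∫ y, Real.exp (φ y / ε) ∂μ :=
          setIntegral_le_integral hi (Filter.Eventually.of_forall fun _ => (Real.exp_pos _).le)
      _ = 1 := hint
  have hm := mul_le_mul_of_nonneg_right (iInf_mSupport_ball_le μ ε hx)
    (Real.exp_pos (φ x / ε - K)).le
  rw [le_div_iff₀ (iInf_mSupport_ball_pos μ hε)]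
  rw [Real.exp_sub] at key hm
  have h3 := hm.trans key
  rw [← mul_div_assoc, div_le_one (Real.exp_pos K)] at h3
  linarith

end SmoothedKernel

theorem Real.abs_exp_sub_exp_le {a b M : ℝ} (ha : Real.exp a ≤ M) (hb : Real.exp b ≤ M) :
    |Real.exp a - Real.exp b| ≤ M * |a - b| := by
  wlog h : b ≤ a generalizing a b
  · rw [abs_sub_comm, abs_sub_comm a]
    exact this hb ha (le_of_not_ge h)
  rw [abs_of_nonneg (sub_nonneg.2 (Real.exp_le_exp.2 h)), abs_of_nonneg (sub_nonneg.2 h)]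
  have h1 : Real.exp a * (b - a + 1) ≤ Real.exp a * Real.exp (b - a) :=
    mul_le_mul_of_nonneg_left (Real.add_one_le_exp _) (Real.exp_pos a).le
  rw [← Real.exp_add, add_sub_cancel] at h1
  have h2 := mul_le_mul_of_nonneg_right ha (sub_nonneg.2 h)
  linarith

/-- **Sup- and Lipschitz bounds for the smoothed kernel `(k₁ : π : k₂)`.**
The convolution kernel `t(x',y') = ∫ k₁(x',x) k₂(y,y') dπ(x,y)` satisfies the uniform
bound `t ≤ exp(2 Lip(c)) / max{inf_{x ∈ spt μ} μ(B(x,ε)), inf_{y ∈ spt ν} ν(B(y,ε))}`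
and is Lipschitz in its first argument with constant
`2 Lip(c) exp(2 Lip(c)) / (ε inf_{x ∈ spt μ} μ(B(x,ε)))`. -/
theorem smoothed_kernel_bounds
    {X : Type*} [MetricSpace X] [CompactSpace X] [MeasurableSpace X] [BorelSpace X]
    (ε : ℝ) (hε : 0 < ε)
    (c : X → X → ℝ) (hc : Continuous fun p : X × X => c p.1 p.2)
    (hsym : ∀ x y, c x y = c y x) (hnn : ∀ x y, 0 ≤ c x y) (hdiag : ∀ x, c x x = 0)
    (Lc : ℝ) (hLc : 0 < Lc)
    (hlip : ∀ x x' y, |c x y - c x' y| ≤ Lc * dist x x')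
    (μ μ' ν ν' : Measure X) [IsProbabilityMeasure μ] [IsProbabilityMeasure μ']
    [IsProbabilityMeasure ν] [IsProbabilityMeasure ν']
    (k₁ k₂ : X → X → ℝ)
    (hk₁ : IsSchrodingerKernel ε c μ' μ k₁)
    (hk₂ : IsSchrodingerKernel ε c ν ν' k₂)
    (π : Measure (X × X)) [IsProbabilityMeasure π]
    (hπ1 : π.map Prod.fst = μ) (hπ2 : π.map Prod.snd = ν)
    (t : X → X → ℝ)
    (ht : ∀ x' y', t x' y' = ∫ p, k₁ x' p.1 * k₂ p.2 y' ∂π) :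
    (∀ x' y', t x' y' ≤
      Real.exp (2 * Lc) /
        max (⨅ x : mSupport μ, (μ (Metric.ball (x : X) ε)).toReal)
            (⨅ y : mSupport ν, (ν (Metric.ball (y : X) ε)).toReal)) ∧
    (∀ x' x'' y', |t x' y' - t x'' y'| ≤
      2 * Lc * Real.exp (2 * Lc) /
        (ε * ⨅ x : mSupport μ, (μ (Metric.ball (x : X) ε)).toReal) * dist x' x'') := by
  obtain ⟨α₁, β₁, hα₁c, hβ₁c, hα₁, hβ₁, hk₁, -, hk₁i⟩ := hk₁
  obtain ⟨α₂, β₂, hα₂c, hβ₂c, hα₂, hβ₂, hk₂, hk₂i, -⟩ := hk₂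
  have hcl (x : X) : Continuous (c x) := hc.comp (Continuous.prodMk_right x)
  have hcr (y : X) : Continuous fun x => c x y := hc.comp (Continuous.prodMk_left y)
  have hβ₁' (y : X) : β₁ y = -ε * Real.log (∫ x, Real.exp ((α₁ x - c y x) / ε) ∂μ') := by
    simp only [hβ₁ y, hsym y]
  have hα₁L := softmin_sub_le hε hcl hlip μ hβ₁c hα₁
  have hβ₁L := softmin_sub_le hε hcl hlip μ' hα₁c hβ₁'
  have hα₂L := softmin_sub_le hε hcl hlip ν' hβ₂c hα₂
  have hk₁c (x' : X) : Continuous (k₁ x') := by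
    have := hcl x'
    rw [show k₁ x' = fun x => Real.exp ((α₁ x' + β₁ x - c x' x) / ε) from funext (hk₁ x')]
    fun_prop
  have hk₂c (y' : X) : Continuous fun y => k₂ y y' := by
    have := hcr y'
    simp only [hk₂]
    fun_prop
  have hk₁0 (x y : X) : 0 ≤ k₁ x y := by rw [hk₁]; positivity
  have hk₂0 (x y : X) : 0 ≤ k₂ x y := by rw [hk₂]; positivity
  have hM₁ (x' x : X) (hx : x ∈ mSupport μ) : k₁ x' x ≤ Real.exp (2 * Lc) /
      ⨅ x : mSupport μ, (μ (Metric.ball (x : X) ε)).toReal := by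
    have hi := hk₁i x'
    simp only [hk₁] at hi ⊢
    refine exp_density_le hε μ (φ := fun x => α₁ x' + β₁ x - c x' x)
      ((continuous_const.add hβ₁c).sub (hcl x')) (by positivity) (fun x y => ?_) hi hx
    have h := (abs_le.1 (hlip x y x')).1
    rw [hsym x, hsym y] at h
    linarith [hβ₁L x y]
  have hM₂ (y y' : X) (hy : y ∈ mSupport ν) : k₂ y y' ≤ Real.exp (2 * Lc) /
      ⨅ y : mSupport ν, (ν (Metric.ball (y : X) ε)).toReal := by
    have hi := hk₂i y'
    simp only [hk₂] at hi ⊢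
    refine exp_density_le hε ν (φ := fun y => α₂ y + β₂ y' - c y y')
      ((hα₂c.add continuous_const).sub (hcr y')) (by positivity) (fun x y => ?_) hi hy
    linarith [hα₂L x y, (abs_le.1 (hlip x y y')).1]
  have hae₁ : ∀ᵐ p ∂π, p.1 ∈ mSupport μ :=
    ae_of_ae_map (p := (· ∈ mSupport μ)) measurable_fst.aemeasurable
      (by rw [hπ1]; exact ae_mem_mSupport μ)
  have hae₂ : ∀ᵐ p ∂π, p.2 ∈ mSupport ν :=
    ae_of_ae_map (p := (· ∈ mSupport ν)) measurable_snd.aemeasurable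
      (by rw [hπ2]; exact ae_mem_mSupport ν)
  have hI₁ (x' : X) : ∫ p, k₁ x' p.1 ∂π = 1 := by
    rw [← hk₁i x', ← hπ1, integral_map measurable_fst.aemeasurable
      (hk₁c x').aestronglyMeasurable]
  have hI₂ (y' : X) : ∫ p, k₂ p.2 y' ∂π = 1 := by
    rw [← hk₂i y', ← hπ2, integral_map measurable_snd.aemeasurable
      (hk₂c y').aestronglyMeasurable]
  have hint₁ (x' : X) : Integrable (fun p => k₁ x' p.1) π :=
    ((hk₁c x').comp continuous_fst).integrable_of_compactSpace π
  have hint₂ (y' : X) : Integrable (fun p => k₂ p.2 y') π :=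
    ((hk₂c y').comp continuous_snd).integrable_of_compactSpace π
  have hint (x' y' : X) : Integrable (fun p => k₁ x' p.1 * k₂ p.2 y') π :=
    (((hk₁c x').comp continuous_fst).mul
      ((hk₂c y').comp continuous_snd)).integrable_of_compactSpace π
  refine ⟨fun x' y' => ?_, fun x' x'' y' => ?_⟩
  · rw [ht]
    rcases max_choice (⨅ x : mSupport μ, (μ (Metric.ball (x : X) ε)).toReal)
      (⨅ y : mSupport ν, (ν (Metric.ball (y : X) ε)).toReal) with h | h <;> rw [h]
    · refine (integral_mono_ae (hint x' y') ((hint₂ y').const_mul _) ?_).trans_eq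
        (by rw [integral_const_mul, hI₂, mul_one])
      filter_upwards [hae₁] with p hp
      exact mul_le_mul_of_nonneg_right (hM₁ x' _ hp) (hk₂0 _ _)
    · refine (integral_mono_ae (hint x' y') ((hint₁ x').mul_const _) ?_).trans_eq
        (by rw [integral_mul_const, hI₁, one_mul])
      filter_upwards [hae₂] with p hp
      exact mul_le_mul_of_nonneg_left (hM₂ _ y' hp) (hk₁0 _ _)
  · rw [ht, ht, ← integral_sub (hint x' y') (hint x'' y'), ← Real.norm_eq_abs]
    refine (norm_integral_le_of_norm_le ((hint₂ y').const_mul _) ?_).trans_eq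
      (by rw [integral_const_mul, hI₂, mul_one])
    filter_upwards [hae₁] with p hp
    rw [← sub_mul, Real.norm_eq_abs, abs_mul, abs_of_nonneg (hk₂0 p.2 y')]
    refine mul_le_mul_of_nonneg_right ?_ (hk₂0 _ _)
    have h1 := hM₁ x' _ hp
    have h2 := hM₁ x'' _ hp
    have hm := iInf_mSupport_ball_pos μ hε
    rw [hk₁] at h1 h2
    rw [hk₁, hk₁]
    refine (Real.abs_exp_sub_exp_le h1 h2).trans ?_
    have h3 : |(α₁ x' + β₁ p.1 - c x' p.1) / ε - (α₁ x'' + β₁ p.1 - c x'' p.1) / ε| ≤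
        2 * Lc * dist x' x'' / ε := by
      rw [← sub_div, abs_div, abs_of_pos hε]
      gcongr
      have h4 := abs_le.1 (hlip x' x'' p.1)
      have h5 := hα₁L x' x''
      have h6 := hα₁L x'' x'
      rw [dist_comm] at h6
      rw [abs_le]
      constructor <;> linarith [h4.1, h4.2]
    refine (mul_le_mul_of_nonneg_left h3 (by positivity)).trans_eq ?_
    field_simp
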